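/- Let A be a ring, B and C be A-algebras, and α : C → B an A-algebra homomorphism. Let J be the kernel of α ⊗ id : C ⊗_A B → B (sending x ⊗ b to α(x)·b), and let D be the kernel of the multiplication map C ⊗_A C → C (where C ⊗_A C is a C-algebra via multiplication on the left factor). Then the B-algebra isomorphism f : (C ⊗_A C) ⊗_C B → C ⊗_A B given by (x ⊗ y) ⊗ b ↦ y ⊗ α(x)·b induces, for every n, a B-linear isomorphism between (D/D^{n+1}) ⊗_C B and J/J^{n+1}. -/

import Mathlib

open TensorProduct

namespace Stmt1Aux

variable (A B C : Type*) [CommRing A] [CommRing B] [CommRing C]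
    [Algebra A B] [Algebra A C] [Algebra C B] [IsScalarTower A C B]

/-- The ideal `D`. -/
abbrev DD : Ideal (C ⊗[A] C) := RingHom.ker (Algebra.TensorProduct.lmul' A (S := C))

/-- The ideal `J`. -/
abbrev JJ : Ideal (B ⊗[A] C) :=
  RingHom.ker (Algebra.TensorProduct.productMap (AlgHom.id A B) (IsScalarTower.toAlgHom A C B))

/-- The base change map. -/
noncomputable def phi : C ⊗[A] C →ₐ[C] B ⊗[A] C :=
  Algebra.TensorProduct.map (Algebra.ofId C B) (AlgHom.id A C)

lemma phi_tmul (x y : C) : phi A B C (x ⊗ₜ y) = algebraMap C B x ⊗ₜ y := by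
  simp [phi, Algebra.ofId_apply]

lemma phi_mem {x : C ⊗[A] C} (hx : x ∈ DD A C) : phi A B C x ∈ JJ A B C := by
  have h : ∀ x : C ⊗[A] C, Algebra.TensorProduct.productMap (AlgHom.id A B)
      (IsScalarTower.toAlgHom A C B) (phi A B C x)
      = algebraMap C B (Algebra.TensorProduct.lmul' A (S := C) x) := by
    intro x
    induction x with
    | zero => simp
    | add x y hx hy => simp only [map_add, hx, hy]
    | tmul x y => simp [phi_tmul]
  rw [RingHom.mem_ker] at hx ⊢
  rw [h, hx, map_zero]

lemma delta_mem (c : C) : (1 : C) ⊗ₜ[A] c - c ⊗ₜ 1 ∈ DD A C := by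
  simp [RingHom.mem_ker]

/-- The projection `B ⊗ C → J`, `w ↦ w - μ w ⊗ 1`. -/
noncomputable def rho : B ⊗[A] C →ₗ[B] B ⊗[A] C :=
  AlgebraTensorModule.lift
    ((LinearMap.toSpanSingleton B (C →ₗ[A] B ⊗[A] C)
      ((TensorProduct.mk A B C 1) -
        ((TensorProduct.mk A B C).flip 1 ∘ₗ (IsScalarTower.toAlgHom A C B).toLinearMap))))

lemma rho_tmul (b : B) (c : C) :
    rho A B C (b ⊗ₜ c) = b • phi A B C ((1 : C) ⊗ₜ[A] c - c ⊗ₜ 1) := by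
  simp [rho, phi_tmul]

lemma rho_eq (w : B ⊗[A] C) : rho A B C w = w -
    (Algebra.TensorProduct.productMap (AlgHom.id A B) (IsScalarTower.toAlgHom A C B) w) ⊗ₜ 1 := by
  induction w with
  | zero => simp
  | add x y hx hy => simp only [map_add, hx, hy, add_tmul]; abel
  | tmul b c => simp [rho_tmul, phi_tmul, smul_sub, smul_tmul']

lemma map_phi : (DD A C).map (phi A B C) = JJ A B C := by
  apply le_antisymm
  · rw [Ideal.map_le_iff_le_comap]
    exact fun x hx => phi_mem A B C hx
  · intro w hw
    have h1 : rho A B C w = w := by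
      rw [rho_eq, (RingHom.mem_ker).1 hw]; simp
    rw [← h1]
    clear h1 hw
    induction w with
    | zero => simp
    | add x y hx hy => rw [map_add]; exact add_mem hx hy
    | tmul b c =>
      rw [rho_tmul, Algebra.smul_def]
      exact Ideal.mul_mem_left _ _ (Ideal.mem_map_of_mem _ (delta_mem A C c))

lemma map_phi_pow (n : ℕ) : ((DD A C) ^ n).map (phi A B C) = (JJ A B C) ^ n := by
  rw [Ideal.map_pow, map_phi]

variable (n : ℕ)

abbrev DB : Ideal (C ⊗[A] C ⧸ (DD A C) ^ (n + 1)) :=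
  Ideal.map (Ideal.Quotient.mk ((DD A C) ^ (n + 1))) (DD A C)

abbrev JB : Ideal (B ⊗[A] C ⧸ (JJ A B C) ^ (n + 1)) :=
  Ideal.map (Ideal.Quotient.mk ((JJ A B C) ^ (n + 1))) (JJ A B C)

/-- `D → D/D^(n+1)`. -/
noncomputable def toDB : ((DD A C).restrictScalars C) →ₗ[C] DB A C n where
  toFun x := ⟨Ideal.Quotient.mk _ x.1, Ideal.mem_map_of_mem _ x.2⟩
  map_add' x y := by ext; simp
  map_smul' x y := by ext; rfl

lemma toDB_surj : Function.Surjective (toDB A C n) := by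
  rintro ⟨x, hx⟩
  obtain ⟨d, hd, rfl⟩ := (Ideal.mem_map_iff_of_surjective _ Ideal.Quotient.mk_surjective).1 hx
  exact ⟨⟨d, hd⟩, rfl⟩

/-- `C ⊗ C → D`. -/
noncomputable def proj : C ⊗[A] C →ₗ[C] ((DD A C).restrictScalars C) where
  toFun x := ⟨x - (Algebra.TensorProduct.lmul' A (S := C) x) ⊗ₜ 1, by
    simp [RingHom.mem_ker]⟩
  map_add' x y := by ext; simp [add_tmul]; abel
  map_smul' c x := by
    ext
    have : Algebra.TensorProduct.lmul' A (S := C) (c • x)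
        = c * Algebra.TensorProduct.lmul' A (S := C) x := by
      rw [Algebra.smul_def, map_mul]; simp
    simp [this, smul_sub, smul_tmul']

lemma proj_of_mem (x : (DD A C).restrictScalars C) : proj A C x.1 = x := by
  ext
  have : Algebra.TensorProduct.lmul' A (S := C) x.1 = 0 := x.2
  simp [proj, this]

/-- The map `B ⊗ C → B ⊗ (D/D^(n+1))`. -/
noncomputable def G : B ⊗[A] C →ₗ[B] B ⊗[C] (DB A C n) :=
  AlgebraTensorModule.lift
    ((LinearMap.toSpanSingleton B (C →ₗ[A] B ⊗[C] (DB A C n))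
      (((TensorProduct.mk C B (DB A C n) 1) ∘ₗ (toDB A C n) ∘ₗ (proj A C)).restrictScalars A ∘ₗ
        (TensorProduct.mk A C C 1))))

lemma G_tmul (b : B) (c : C) :
    G A B C n (b ⊗ₜ c) = b ⊗ₜ (toDB A C n (proj A C (1 ⊗ₜ c))) := by
  simp [G, smul_tmul']

lemma G_phi (x : C ⊗[A] C) : G A B C n (phi A B C x) = 1 ⊗ₜ toDB A C n (proj A C x) := by
  induction x with
  | zero => simp
  | add x y hx hy => simp only [map_add, hx, hy, tmul_add]
  | tmul x y =>
    rw [phi_tmul, G_tmul]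
    have : x ⊗ₜ[A] y = x • ((1 : C) ⊗ₜ[A] y) := by simp [smul_tmul']
    rw [this, map_smul, map_smul, tmul_smul, smul_tmul', Algebra.smul_def, mul_one]

lemma G_mul_zero {w : B ⊗[A] C} (hw : w ∈ (JJ A B C) ^ (n + 1)) :
    ∀ z : B ⊗[A] C, G A B C n (z * w) = 0 := by
  rw [← map_phi_pow, Ideal.map] at hw
  induction hw using Submodule.span_induction with
  | zero => simp
  | add x y _ _ hx hy => intro z; rw [mul_add, map_add, hx, hy, add_zero]
  | smul a x _ h => intro z; rw [smul_eq_mul, ← mul_assoc]; exact h _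
  | mem x hx =>
    obtain ⟨d, hd, rfl⟩ := hx
    intro z
    induction z with
    | zero => simp
    | add x y hx hy => rw [add_mul, map_add, hx, hy, add_zero]
    | tmul b c =>
      have h1 : b ⊗ₜ[A] c = b • phi A B C (1 ⊗ₜ c) := by simp [phi_tmul, smul_tmul']
      have h2 : (1 : C) ⊗ₜ[A] c * d ∈ (DD A C) ^ (n + 1) := Ideal.mul_mem_left _ _ hd
      have h3 : (1 : C) ⊗ₜ[A] c * d ∈ DD A C := Ideal.pow_le_self (Nat.succ_ne_zero n) h2
      have h4 := proj_of_mem A C ⟨_, h3⟩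
      have h5 : toDB A C n ⟨_, h3⟩ = 0 := Subtype.ext (Ideal.Quotient.eq_zero_iff_mem.2 h2)
      rw [h1, smul_mul_assoc]
      erw [← map_mul (phi A B C)]
      rw [map_smul, G_phi]
      erw [h4, h5]
      simp

lemma G_zero {w : B ⊗[A] C} (hw : w ∈ (JJ A B C) ^ (n + 1)) : G A B C n w = 0 := by
  simpa using G_mul_zero A B C n hw 1

/-- The induced map on quotients. -/
noncomputable def phiQ :
    (C ⊗[A] C ⧸ (DD A C) ^ (n + 1)) →ₐ[C] (B ⊗[A] C ⧸ (JJ A B C) ^ (n + 1)) :=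
  Ideal.quotientMapₐ _ (phi A B C) (by
    rw [← Ideal.map_le_iff_le_comap]; exact (map_phi_pow A B C (n + 1)).le)

/-- The main map. -/
noncomputable def Psi0 : B ⊗[C] (DB A C n) →ₗ[B] (B ⊗[A] C ⧸ (JJ A B C) ^ (n + 1)) :=
  LinearMap.liftBaseChange B
    ((phiQ A B C n).toLinearMap ∘ₗ ((DB A C n).restrictScalars C).subtype)

lemma Psi0_tmul (b : B) (x : (DD A C).restrictScalars C) :
    Psi0 A B C n (b ⊗ₜ toDB A C n x) = Ideal.Quotient.mk _ (b • phi A B C x.1) := by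
  simp only [Psi0, LinearMap.liftBaseChange_tmul]
  rfl

lemma Psi0_G (w : B ⊗[A] C) : Psi0 A B C n (G A B C n w) = Ideal.Quotient.mk _ (rho A B C w) := by
  induction w with
  | zero => simp
  | add x y hx hy => simp only [map_add, hx, hy]
  | tmul b c =>
    rw [G_tmul, Psi0_tmul, rho_tmul]
    simp [proj]

lemma exists_lift (z : B ⊗[C] (DB A C n)) : ∃ w ∈ JJ A B C,
    Ideal.Quotient.mk _ w = Psi0 A B C n z ∧ G A B C n w = z := by
  induction z with
  | zero => exact ⟨0, zero_mem _, by simp, by simp⟩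
  | add x y hx hy =>
    obtain ⟨u, hu, hu1, hu2⟩ := hx
    obtain ⟨v, hv, hv1, hv2⟩ := hy
    exact ⟨u + v, add_mem hu hv, by rw [map_add, map_add, hu1, hv1], by rw [map_add, hu2, hv2]⟩
  | tmul b d =>
    obtain ⟨x, rfl⟩ := toDB_surj A C n d
    refine ⟨b • phi A B C x.1, ?_, (Psi0_tmul A B C n b x).symm, ?_⟩
    · rw [Algebra.smul_def]
      exact Ideal.mul_mem_left _ _ (phi_mem A B C x.2)
    · rw [map_smul, G_phi, proj_of_mem, smul_tmul', smul_eq_mul, mul_one]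

lemma Psi0_mem (z : B ⊗[C] (DB A C n)) :
    Psi0 A B C n z ∈ (JB A B C n).restrictScalars B := by
  obtain ⟨w, hw, h, -⟩ := exists_lift A B C n z
  rw [← h]
  exact Ideal.mem_map_of_mem _ hw

lemma bij : Function.Bijective ((Psi0 A B C n).codRestrict _ (Psi0_mem A B C n)) := by
  constructor
  · rw [injective_iff_map_eq_zero]
    intro z hz
    have hz' : Psi0 A B C n z = 0 := congrArg Subtype.val hz
    obtain ⟨w, hw, h, h'⟩ := exists_lift A B C n z
    rw [hz', Ideal.Quotient.eq_zero_iff_mem] at h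
    rw [← h', G_zero A B C n h]
  · rintro ⟨x, hx⟩
    obtain ⟨w, hw, rfl⟩ := (Ideal.mem_map_iff_of_surjective _ Ideal.Quotient.mk_surjective).1 hx
    refine ⟨G A B C n w, Subtype.ext ?_⟩
    have h1 : rho A B C w = w := by
      rw [rho_eq, (RingHom.mem_ker).1 hw]; simp
    change Psi0 A B C n (G A B C n w) = _
    rw [Psi0_G, h1]

end Stmt1Aux


/-- with `D = ker (mult : C ⊗[A] C → C)` (a `C`-module via the left factor)
and `J = ker (α ⊗ id : C ⊗[A] B → B)` (written here with the tensor factors swapped,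
`B ⊗[A] C → B`, so that the `B`-module structures are the evident ones, and with
`α = algebraMap C B`), the isomorphism `f` of Lemma 5.2 induces a `B`-linear isomorphism
`(D/D^{n+1}) ⊗_C B ≅ J/J^{n+1}`. -/
theorem stmt_1 (A B C : Type*) [CommRing A] [CommRing B] [CommRing C]
    [Algebra A B] [Algebra A C] [Algebra C B] [IsScalarTower A C B] (n : ℕ) :
    Nonempty
      ((B ⊗[C]
          ↥(Ideal.map
              (Ideal.Quotient.mk
                ((RingHom.ker (Algebra.TensorProduct.lmul' A (S := C))) ^ (n + 1)))
              (RingHom.ker (Algebra.TensorProduct.lmul' A (S := C)))))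
        ≃ₗ[B]
        ↥(Ideal.map
            (Ideal.Quotient.mk
              ((RingHom.ker
                  (Algebra.TensorProduct.productMap (AlgHom.id A B)
                    (IsScalarTower.toAlgHom A C B))) ^ (n + 1)))
            (RingHom.ker
              (Algebra.TensorProduct.productMap (AlgHom.id A B)
                (IsScalarTower.toAlgHom A C B))))) := by
  exact ⟨LinearEquiv.ofBijective _ (Stmt1Aux.bij A B C n)⟩
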